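/- Let Σ be a finite alphabet, n a natural number, and consider words of length n over Σ (functions from Fin n to Σ) with the Hamming distance (which equals the substitution-only Levenshtein distance for equal-length words). Fix a real number α > 0 and a natural number k. Then for all words w₁, w₂, v of length n over Σ with hammingDist w₁ w₂ ≤ k, it holds that |1/(hammingDist w₁ v + α) − 1/(hammingDist w₂ v + α)| ≤ k/(α·(k + α)). -/

import Mathlib

theorem sens_aux (a b k α : ℝ) (ha : 0 ≤ a) (hb : 0 ≤ b) (hk : 0 ≤ k) (hα : 0 < α)
    (h : b ≤ a + k) : 1 / (a + α) - 1 / (b + α) ≤ k / (α * (k + α)) := by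
  have h1 : 1 / (a + k + α) ≤ 1 / (b + α) :=
    one_div_le_one_div_of_le (by linarith) (by linarith)
  have h2 : 1 / (a + α) - 1 / (a + k + α) = k / ((a + α) * (a + k + α)) := by
    have : a + α ≠ 0 := by positivity
    have : a + k + α ≠ 0 := by positivity
    field_simp
    ring
  have h3 : k / ((a + α) * (a + k + α)) ≤ k / (α * (k + α)) := by
    apply div_le_div_of_nonneg_left hk (by positivity)
    apply mul_le_mul <;> first | linarith | positivity
  linarith

theorem sensitivity_bound_hamming
    {A : Type*} [Fintype A] [DecidableEq A] (n : ℕ)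
    (α : ℝ) (hα : 0 < α) (k : ℕ)
    (w₁ w₂ v : Fin n → A) (hadj : hammingDist w₁ w₂ ≤ k) :
    |1 / ((hammingDist w₁ v : ℝ) + α) - 1 / ((hammingDist w₂ v : ℝ) + α)|
      ≤ (k : ℝ) / (α * ((k : ℝ) + α)) := by
  have t1 := hammingDist_triangle w₁ w₂ v
  have t2 := hammingDist_triangle w₂ w₁ v
  rw [hammingDist_comm w₂ w₁] at t2
  have e1 : hammingDist w₁ v ≤ hammingDist w₂ v + k := by omega
  have e2 : hammingDist w₂ v ≤ hammingDist w₁ v + k := by omega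
  rw [abs_sub_le_iff]
  constructor
  · exact sens_aux _ _ _ _ (by positivity) (by positivity) (by positivity) hα (by exact_mod_cast e2)
  · exact sens_aux _ _ _ _ (by positivity) (by positivity) (by positivity) hα (by exact_mod_cast e1)
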